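/- A commutative integral domain R is finitely stable if and only if R ⊆ R̄ is a quadratic extension, R̄ is a Prüfer domain, and for every maximal ideal m of R there are at most two maximal ideals of R̄ lying over m. -/

import Mathlib

noncomputable section

open scoped nonZeroDivisors Pointwise

set_option synthInstance.maxHeartbeats 1000000
set_option maxHeartbeats 1000000

/-- For a nonzero ideal `I` of a domain `R`, viewed as a fractional ideal `J` of the quotient
field, the endomorphism ring `(I : I)` is `J / J` and `{z ∈ K | zI ⊆ (I : I)}` is `J / J / J`.
The ideal `I` is *stable* if it is invertible as an ideal of `(I : I)`, i.e.
`I * ((I:I) : I) = (I:I)`. -/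
def Ideal.IsStableIdeal {R : Type*} [CommRing R] [IsDomain R] (I : Ideal R) : Prop :=
  (I : FractionalIdeal R⁰ (FractionRing R)) *
      ((I : FractionalIdeal R⁰ (FractionRing R)) / (I : FractionalIdeal R⁰ (FractionRing R)) /
        (I : FractionalIdeal R⁰ (FractionRing R))) =
    (I : FractionalIdeal R⁰ (FractionRing R)) / (I : FractionalIdeal R⁰ (FractionRing R))

/-- A domain is *stable* if every nonzero ideal is stable. -/
def StableRing (R : Type*) [CommRing R] [IsDomain R] : Prop :=
  ∀ I : Ideal R, I ≠ ⊥ → I.IsStableIdeal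

/-- A domain is *finitely stable* if every nonzero finitely generated ideal is stable. -/
def FinitelyStableRing (R : Type*) [CommRing R] [IsDomain R] : Prop :=
  ∀ I : Ideal R, I ≠ ⊥ → I.FG → I.IsStableIdeal

/-- The extension `R ⊆ R̄` (integral closure inside the quotient field) is *quadratic* if
`xy ∈ xR + yR + R` for all `x, y ∈ R̄`. -/
def QuadraticClosureExtension (R : Type*) [CommRing R] [IsDomain R] : Prop :=
  ∀ x y : FractionRing R, x ∈ integralClosure R (FractionRing R) →
    y ∈ integralClosure R (FractionRing R) →
    ∃ a b c : R, x * y = algebraMap R (FractionRing R) a * x +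
      algebraMap R (FractionRing R) b * y + algebraMap R (FractionRing R) c

/-- A nonzero ideal of a domain is *invertible* if it is invertible as a fractional ideal. -/
def Ideal.IsInvertibleIdeal {R : Type*} [CommRing R] [IsDomain R] (I : Ideal R) : Prop :=
  IsUnit (I : FractionalIdeal R⁰ (FractionRing R))

/-- A domain is a *Prüfer domain* if every nonzero finitely generated ideal is invertible. -/
def PruferRing (R : Type*) [CommRing R] [IsDomain R] : Prop :=
  ∀ I : Ideal R, I ≠ ⊥ → I.FG → I.IsInvertibleIdeal

section Helpers

variable {R : Type*} [CommRing R] [IsDomain R]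

/-- Submodule version of stability. -/
def StabSub {R K : Type*} [CommRing R] [Field K] [Algebra R K] (N : Submodule R K) : Prop :=
  (1 : K) ∈ N * (N / N / N)

lemma stab_mul_le {R K : Type*} [CommRing R] [Field K] [Algebra R K] (N : Submodule R K) :
    N * (N / N / N) ≤ N / N := by
  rw [mul_comm]
  exact Submodule.le_div_iff_mul_le.1 le_rfl

lemma div_self_mul {R K : Type*} [CommRing R] [Field K] [Algebra R K] (N : Submodule R K) :
    (N / N) * (N / N) ≤ N / N := by
  rw [Submodule.mul_le]
  intro x hx y hy
  rw [Submodule.mem_div_iff_forall_mul_mem] at *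
  intro z hz
  rw [mul_assoc]
  exact hx _ (hy _ hz)

lemma stable_iff_stabSub (I : Ideal R) (hI : I ≠ ⊥) :
    I.IsStableIdeal ↔ StabSub (IsLocalization.coeSubmodule (FractionRing R) I) := by
  have h0 : (I : FractionalIdeal R⁰ (FractionRing R)) ≠ 0 := by
    simpa using hI
  unfold Ideal.IsStableIdeal StabSub
  rw [← FractionalIdeal.coeToSubmodule_inj, FractionalIdeal.coe_mul, FractionalIdeal.coe_div h0,
    FractionalIdeal.coe_div h0, FractionalIdeal.coe_coeIdeal]
  set N := IsLocalization.coeSubmodule (FractionRing R) I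
  constructor
  · intro h
    rw [h, Submodule.mem_div_iff_forall_mul_mem]
    intro y hy
    simpa using hy
  · intro h
    apply le_antisymm (stab_mul_le N)
    intro z hz
    have h1 : z * 1 ∈ (N / N) * (N * (N / N / N)) := Submodule.mul_mem_mul hz h
    rw [mul_one, ← mul_assoc] at h1
    have h2 : (N / N) * N ≤ N := Submodule.le_div_iff_mul_le.1 le_rfl
    have h3 : (N / N) * N * (N / N / N) ≤ N * (N / N / N) := mul_le_mul' h2 le_rfl
    exact h3 h1

lemma stabSub_of_fg (h : FinitelyStableRing R) (N : Submodule R (FractionRing R)) (hN : N.FG)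
    (hN0 : N ≠ ⊥) : StabSub N := by
  obtain ⟨d, hd, hdN⟩ := FractionalIdeal.isFractional_of_fg (S := R⁰) hN
  have hd0 : algebraMap R (FractionRing R) d ≠ 0 := by
    simpa using nonZeroDivisors.ne_zero hd
  let N' : Submodule R (FractionRing R) := N.map (LinearMap.lsmul R (FractionRing R) d)
  let I : Ideal R := N'.comap (Algebra.linearMap R (FractionRing R))
  have hI : IsLocalization.coeSubmodule (FractionRing R) I = N' := by
    apply le_antisymm
    · exact Submodule.map_comap_le _ _
    · rintro _ ⟨n, hn, rfl⟩
      obtain ⟨r, hr⟩ := hdN n hn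
      refine ⟨r, ?_, hr⟩
      exact ⟨n, hn, hr.symm⟩
  have hIfg : I.FG := by
    refine (IsLocalization.coeSubmodule_fg (FractionRing R)
      (IsFractionRing.injective R (FractionRing R)) I).1 ?_
    rw [hI]
    exact hN.map _
  have hI0 : I ≠ ⊥ := by
    rintro hb
    rw [hb] at hI
    apply hN0
    rw [eq_bot_iff]
    intro n hn
    have : d • n ∈ N' := ⟨n, hn, rfl⟩
    rw [← hI] at this
    simp only [IsLocalization.coeSubmodule_bot, Submodule.mem_bot, Algebra.smul_def,
      mul_eq_zero] at this
    simpa [hd0] using this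
  have hs := (stable_iff_stabSub I hI0).1 (h I hI0 hIfg)
  rw [hI] at hs
  have hle : N' * (N' / N' / N') ≤ N * (N / N / N) := by
    rw [Submodule.mul_le]
    rintro _ ⟨n, hn, rfl⟩ u hu
    have : (LinearMap.lsmul R (FractionRing R) d) n * u = n * (d • u) := by
      simp
    rw [this]
    refine Submodule.mul_mem_mul hn ?_
    rw [Submodule.mem_div_iff_forall_mul_mem] at *
    intro y hy
    rw [Submodule.mem_div_iff_forall_mul_mem]
    intro z hz
    have h1 := hu (d • y) ⟨y, hy, rfl⟩
    rw [Submodule.mem_div_iff_forall_mul_mem] at h1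
    obtain ⟨w, hw, hw'⟩ := h1 (d • z) ⟨z, hz, rfl⟩
    have : w = d • u * y * z := by
      simp only [LinearMap.lsmul_apply, Algebra.smul_def] at hw' ⊢
      apply mul_left_cancel₀ hd0
      rw [hw']
      ring
    rw [← this]
    exact hw
  exact hle hs

lemma invertible_iff {S K : Type*} [CommRing S] [IsDomain S] [Field K] [Algebra S K]
    [IsFractionRing S K] (L : Ideal S) (hL : L ≠ ⊥) :
    L.IsInvertibleIdeal ↔
      (1 : K) ∈ IsLocalization.coeSubmodule K L * (1 / IsLocalization.coeSubmodule K L) := by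
  have h0 : (L : FractionalIdeal S⁰ K) ≠ 0 := by
    simpa using hL
  have h1 : L.IsInvertibleIdeal ↔ IsUnit (L : FractionalIdeal S⁰ K) := by
    unfold Ideal.IsInvertibleIdeal
    rw [← FractionalIdeal.canonicalEquiv_coeIdeal (S := S⁰) (P := FractionRing S) (P' := K) L]
    exact (MulEquiv.isUnit_map
      (FractionalIdeal.canonicalEquiv S⁰ (FractionRing S) K)).symm
  rw [h1, ← FractionalIdeal.mul_inv_cancel_iff_isUnit, ← FractionalIdeal.coeToSubmodule_inj,
    FractionalIdeal.coe_mul, FractionalIdeal.inv_eq, FractionalIdeal.coe_div h0,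
    FractionalIdeal.coe_coeIdeal, FractionalIdeal.coe_one]
  constructor
  · intro h
    rw [h]
    exact Submodule.one_le.1 le_rfl
  · intro h
    apply le_antisymm
    · rw [mul_comm]
      exact Submodule.le_div_iff_mul_le.1 le_rfl
    · rwa [Submodule.one_le]

lemma quadratic_of_stable (h : FinitelyStableRing R) : QuadraticClosureExtension R := by
  intro x y hx hy
  let N : Submodule R (FractionRing R) := Submodule.span R {1, x, y}
  have h1N : (1 : FractionRing R) ∈ N := Submodule.subset_span (by simp)
  have hxN : x ∈ N := Submodule.subset_span (by simp)
  have hyN : y ∈ N := Submodule.subset_span (by simp)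
  have h1le : 1 ≤ N := by rwa [Submodule.one_le]
  have hs : StabSub N := by
    apply stabSub_of_fg h N (Submodule.fg_span (by simp))
    intro hb
    rw [hb] at h1N
    simp at h1N
  let A := Algebra.adjoin R ({x, y} : Set (FractionRing R))
  let T : Submodule R (FractionRing R) := Subalgebra.toSubmodule A
  have hTfg : T.FG := by
    apply fg_adjoin_of_finite (by simp)
    intro z hz
    rcases hz with rfl | rfl
    · exact hx
    · exact hy
  have hNT : N ≤ T := by
    apply Submodule.span_le.2
    rintro z (rfl | rfl | rfl)
    · exact A.one_mem
    · exact Algebra.subset_adjoin (by simp)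
    · exact Algebra.subset_adjoin (by simp)
  have hTT : T * T = T := by
    have := Subalgebra.mul_toSubmodule A A
    rwa [sup_idem] at this
  have hpow : ∀ n, T * N ^ n ≤ T := by
    intro n
    induction n with
    | zero => simp
    | succ k ih =>
      calc T * N ^ (k + 1) = (T * N ^ k) * N := by rw [pow_succ, mul_assoc]
        _ ≤ T * T := mul_le_mul' ih hNT
        _ = T := hTT
  have h1T : 1 ≤ T := h1le.trans hNT
  have hmono : Monotone (fun n : ℕ => N ^ n) := by
    apply monotone_nat_of_le_succ
    intro n
    calc N ^ n = N ^ n * 1 := by rw [mul_one]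
      _ ≤ N ^ n * N := mul_le_mul' le_rfl h1le
      _ = N ^ (n + 1) := by rw [pow_succ]
  have hpowT : ∀ n, N ^ n ≤ T := fun n => by
    calc N ^ n = 1 * N ^ n := by rw [one_mul]
      _ ≤ T * N ^ n := mul_le_mul' h1T le_rfl
      _ ≤ T := hpow n
  obtain ⟨n, hn⟩ : ∃ n, T = N ^ n := by
    refine hTfg.stabilizes_of_iSup_eq ⟨fun n => N ^ n, hmono⟩ ?_
    apply le_antisymm (iSup_le hpowT)
    intro z hz
    have hz' : z ∈ A := hz
    have key : ∃ n : ℕ, z ∈ N ^ n := by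
      induction hz' using Algebra.adjoin_induction with
      | mem w hw =>
        refine ⟨1, ?_⟩
        rw [pow_one]
        rcases hw with rfl | rfl
        · exact hxN
        · exact hyN
      | algebraMap r =>
        refine ⟨0, ?_⟩
        rw [pow_zero]
        exact Submodule.algebraMap_mem r
      | add a b ha hb iha ihb =>
        obtain ⟨i, hi⟩ := iha ha
        obtain ⟨j, hj⟩ := ihb hb
        exact ⟨max i j, add_mem (hmono (le_max_left i j) hi) (hmono (le_max_right i j) hj)⟩
      | mul a b ha hb iha ihb =>
        obtain ⟨i, hi⟩ := iha ha
        obtain ⟨j, hj⟩ := ihb hb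
        refine ⟨i + j, ?_⟩
        rw [pow_add]
        exact Submodule.mul_mem_mul hi hj
    obtain ⟨n, hn⟩ := key
    exact (le_iSup (fun n : ℕ => N ^ n) n) hn
  have hE1 : 1 ≤ N / N := by
    rw [Submodule.one_le, Submodule.mem_div_iff_forall_mul_mem]
    intro z hz
    simpa using hz
  have hEpow : ∀ k, (N / N) ^ k ≤ N / N := by
    intro k
    induction k with
    | zero => rw [pow_zero]; exact hE1
    | succ k ih =>
      rw [pow_succ]
      exact (mul_le_mul' ih le_rfl).trans (div_self_mul N)
  have hJ1 : ∀ k, 1 ≤ (N * (N / N / N)) ^ k := by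
    intro k
    induction k with
    | zero => simp
    | succ k ih =>
      rw [pow_succ]
      calc (1 : Submodule R (FractionRing R)) = 1 * 1 := by rw [mul_one]
        _ ≤ _ := mul_le_mul' ih (by rw [Submodule.one_le]; exact hs)
  have hfin : T ≤ N := by
    calc T = T * 1 := by rw [mul_one]
      _ ≤ T * (N * (N / N / N)) ^ n := mul_le_mul' le_rfl (hJ1 n)
      _ = (T * N ^ n) * (N / N / N) ^ n := by rw [mul_pow, mul_assoc]
      _ ≤ T * (N / N / N) ^ n := mul_le_mul' (hpow n) le_rfl
      _ = (N * (N / N / N)) ^ n := by rw [hn, mul_pow]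
      _ ≤ (N / N) ^ n := pow_le_pow_left' (stab_mul_le N) n
      _ ≤ N / N := hEpow n
      _ = (N / N) * 1 := by rw [mul_one]
      _ ≤ (N / N) * N := mul_le_mul' le_rfl h1le
      _ ≤ N := Submodule.le_div_iff_mul_le.1 le_rfl
  have hxy : x * y ∈ N := by
    apply hfin
    exact A.mul_mem (Algebra.subset_adjoin (by simp)) (Algebra.subset_adjoin (by simp))
  obtain ⟨a, b, c, habc⟩ := Submodule.mem_span_triple.1 hxy
  refine ⟨b, c, a, ?_⟩
  rw [← habc]
  simp only [Algebra.smul_def]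
  ring

lemma integral_of_mem_div (N : Submodule R (FractionRing R)) (hN : N.FG) (hN0 : N ≠ ⊥)
    (z : FractionRing R) (hz : z ∈ N / N) : z ∈ integralClosure R (FractionRing R) := by
  rw [Submodule.mem_div_iff_forall_mul_mem] at hz
  refine isIntegral_of_smul_mem_submodule N ?_ hN z hz
  exact hN0

instance fracInst : IsFractionRing (integralClosure R (FractionRing R)) (FractionRing R) :=
  integralClosure.isFractionRing_of_finite_extension (FractionRing R) (FractionRing R)

lemma prufer_of_stable (h : FinitelyStableRing R) :
    PruferRing ↥(integralClosure R (FractionRing R)) := by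
  intro L hL hfg
  rw [invertible_iff (K := FractionRing R) L hL]
  obtain ⟨s, hs⟩ := hfg
  let N : Submodule R (FractionRing R) :=
    Submodule.span R ((algebraMap (integralClosure R (FractionRing R)) (FractionRing R)) '' s)
  have hNfg : N.FG := Submodule.fg_span (s.finite_toSet.image _)
  have hN0 : N ≠ ⊥ := by
    intro hb
    apply hL
    rw [← hs, Submodule.span_eq_bot]
    intro x hx
    have : algebraMap (integralClosure R (FractionRing R)) (FractionRing R) x ∈ N :=
      Submodule.subset_span ⟨x, hx, rfl⟩
    rw [hb] at this
    simpa using this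
  have hst : StabSub N := stabSub_of_fg h N hNfg hN0
  let P := IsLocalization.coeSubmodule (FractionRing R) L
  have hNP : N ≤ P.restrictScalars R := by
    rw [Submodule.span_le]
    rintro _ ⟨x, hx, rfl⟩
    exact ⟨x, hs ▸ Submodule.subset_span hx, rfl⟩
  have hJ : N / N / N ≤ (1 / P).restrictScalars R := by
    intro z hz
    rw [Submodule.restrictScalars_mem, Submodule.mem_div_iff_forall_mul_mem]
    rintro _ ⟨x, hx, rfl⟩
    change x ∈ L at hx
    rw [← hs] at hx
    induction hx using Submodule.span_induction with
    | mem x hx =>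
      rw [Submodule.mem_div_iff_forall_mul_mem] at hz
      have := hz _ (Submodule.subset_span ⟨x, hx, rfl⟩)
      have := integral_of_mem_div N hNfg hN0 _ this
      exact Submodule.mem_one.2 ⟨⟨_, this⟩, rfl⟩
    | zero => simp
    | add a b _ _ ha hb => rw [map_add, mul_add]; exact add_mem ha hb
    | smul r a _ ha =>
      rw [map_smul, mul_smul_comm]
      exact Submodule.smul_mem _ _ ha
  have hle : N * (N / N / N) ≤ (P * (1 / P)).restrictScalars R := by
    rw [Submodule.mul_le]
    intro x hx y hy
    have hx' : x ∈ P := hNP hx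
    have hy' : y ∈ 1 / P := hJ hy
    have hxy : x * y ∈ P * (1 / P) := Submodule.mul_mem_mul hx' hy'
    exact (Submodule.restrictScalars_mem R _ _).2 hxy
  exact (Submodule.restrictScalars_mem R _ _).1 (hle hst)

lemma two_of_stable (h : FinitelyStableRing R) (m : Ideal R) (_ : m.IsMaximal) :
    ∃ q₁ q₂ : Ideal ↥(integralClosure R (FractionRing R)),
            ∀ q : Ideal ↥(integralClosure R (FractionRing R)), q.IsMaximal →
              Ideal.comap (algebraMap R ↥(integralClosure R (FractionRing R))) q = m →
              q = q₁ ∨ q = q₂ := by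
  by_contra! hcon
  obtain ⟨q₁, hq₁, hc₁, -, -⟩ := hcon ⊥ ⊥
  obtain ⟨q₂, hq₂, hc₂, h21, -⟩ := hcon q₁ q₁
  obtain ⟨q₃, hq₃, hc₃, h31, h32⟩ := hcon q₁ q₂
  let S := integralClosure R (FractionRing R)
  have hcrt : ∀ a b c : S, ∃ r : S, r - a ∈ q₁ ∧ r - b ∈ q₂ ∧ r - c ∈ q₃ := by
    intro a b c
    have hpw : Pairwise (Function.onFun IsCoprime ![q₁, q₂, q₃]) := by
      intro i j hij
      rw [Function.onFun, Ideal.isCoprime_iff_sup_eq]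
      fin_cases i <;> fin_cases j <;> simp at hij ⊢ <;>
        exact Ideal.IsMaximal.coprime_of_ne ‹_› ‹_› (by first | assumption | (symm; assumption))
    obtain ⟨r, hr⟩ := Ideal.exists_forall_sub_mem_ideal hpw ![a, b, c]
    exact ⟨r, hr 0, hr 1, hr 2⟩
  obtain ⟨x, hx1, hx2, hx3⟩ := hcrt 1 0 1
  obtain ⟨y, hy1, hy2, hy3⟩ := hcrt 0 1 1
  have hmem1 : ∀ r : R, r ∈ m ↔ algebraMap R S r ∈ q₁ := fun r => by rw [← hc₁]; rfl
  have hmem2 : ∀ r : R, r ∈ m ↔ algebraMap R S r ∈ q₂ := fun r => by rw [← hc₂]; rfl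
  have hmem3 : ∀ r : R, r ∈ m ↔ algebraMap R S r ∈ q₃ := fun r => by rw [← hc₃]; rfl
  rw [sub_zero] at hx2 hy1
  let N : Submodule R (FractionRing R) := Submodule.span R {(x : FractionRing R), (y : FractionRing R)}
  have hNfg : N.FG := Submodule.fg_span (by simp)
  have hxN : (x : FractionRing R) ∈ N := Submodule.subset_span (by simp)
  have hyN : (y : FractionRing R) ∈ N := Submodule.subset_span (by simp)
  have hN0 : N ≠ ⊥ := by
    intro hb
    rw [hb, Submodule.mem_bot] at hxN
    have hx0 : x = 0 := Subtype.ext hxN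
    rw [hx0, zero_sub, neg_mem_iff] at hx1
    exact hq₁.ne_top ((Ideal.eq_top_iff_one _).2 hx1)
  have hst : StabSub N := stabSub_of_fg h N hNfg hN0
  -- elements of `E` are diagonal
  have hE : ∀ z : FractionRing R, z ∈ N / N → ∃ w : S, (w : FractionRing R) = z ∧
      ∃ a : R, w - algebraMap R S a ∈ q₁ ∧ w - algebraMap R S a ∈ q₂ := by
    intro z hz
    refine ⟨⟨z, integral_of_mem_div N hNfg hN0 z hz⟩, rfl, ?_⟩
    set w : S := ⟨z, integral_of_mem_div N hNfg hN0 z hz⟩ with hw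
    rw [Submodule.mem_div_iff_forall_mul_mem] at hz
    obtain ⟨a, b, hab⟩ := Submodule.mem_span_pair.1 (hz _ hxN)
    obtain ⟨c, d, hcd⟩ := Submodule.mem_span_pair.1 (hz _ hyN)
    have e1 : w * x = algebraMap R S a * x + algebraMap R S b * y := by
      apply Subtype.ext
      rw [← Algebra.smul_def, ← Algebra.smul_def]
      exact hab.symm
    have e2 : w * y = algebraMap R S c * x + algebraMap R S d * y := by
      apply Subtype.ext
      rw [← Algebra.smul_def, ← Algebra.smul_def]
      exact hcd.symm
    generalize hA : algebraMap R S a = A at *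
    generalize hB : algebraMap R S b = B at *
    generalize hC : algebraMap R S c = C at *
    generalize hD : algebraMap R S d = D at *
    have f1 : w - A ∈ q₁ := by
      have : w - A = B * y - (w - A) * (x - 1) := by linear_combination e1
      rw [this]
      exact sub_mem (Ideal.mul_mem_left _ _ hy1) (Ideal.mul_mem_left _ _ hx1)
    have f2 : w - D ∈ q₂ := by
      have : w - D = C * x - (w - D) * (y - 1) := by linear_combination e2
      rw [this]
      exact sub_mem (Ideal.mul_mem_left _ _ hx2) (Ideal.mul_mem_left _ _ hy2)
    have f3 : C ∈ q₁ := by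
      have : C = w * y - D * y - C * (x - 1) := by linear_combination -e2
      rw [this]
      exact sub_mem (sub_mem (Ideal.mul_mem_left _ _ hy1) (Ideal.mul_mem_left _ _ hy1))
        (Ideal.mul_mem_left _ _ hx1)
    have f4 : B ∈ q₂ := by
      have : B = w * x - A * x - B * (y - 1) := by linear_combination -e1
      rw [this]
      exact sub_mem (sub_mem (Ideal.mul_mem_left _ _ hx2) (Ideal.mul_mem_left _ _ hx2))
        (Ideal.mul_mem_left _ _ hy2)
    have f5 : C ∈ q₃ := by rw [← hC, ← hmem3, hmem1, hC]; exact f3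
    have f6 : B ∈ q₃ := by rw [← hB, ← hmem3, hmem2, hB]; exact f4
    have f7 : D - A ∈ q₃ := by
      have : D - A = B * y - C * x - (w - A) * (x - 1) + (w - D) * (y - 1) := by
        linear_combination e1 - e2
      rw [this]
      exact add_mem (sub_mem (sub_mem (Ideal.mul_mem_right _ _ f6) (Ideal.mul_mem_right _ _ f5))
        (Ideal.mul_mem_left _ _ hx3)) (Ideal.mul_mem_left _ _ hy3)
    have f8 : D - A ∈ q₂ := by
      rw [← hA, ← hD, ← map_sub, ← hmem2, hmem3, map_sub, hA, hD]; exact f7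
    refine ⟨a, ?_, ?_⟩
    · rw [hA]; exact f1
    · rw [hA]
      have : w - A = (w - D) + (D - A) := by ring
      rw [this]
      exact add_mem f2 f8
  -- every product in `N * J` has `q₁` part zero
  have key : ∀ u ∈ N / N / N, ∀ n ∈ N, ∃ w : S, (w : FractionRing R) = n * u ∧ w ∈ q₁ := by
    intro u hu n hn
    rw [Submodule.mem_div_iff_forall_mul_mem] at hu
    obtain ⟨p, hp, a, ha1, ha2⟩ := hE _ (hu _ hxN)
    obtain ⟨r, hr, b, hb1, hb2⟩ := hE _ (hu _ hyN)
    have e : p * y = r * x := by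
      apply Subtype.ext
      change (p : FractionRing R) * y = r * x
      rw [hp, hr]
      ring
    have hr1 : r ∈ q₁ := by
      have : r = p * y - r * (x - 1) := by linear_combination -e
      rw [this]
      exact sub_mem (Ideal.mul_mem_left _ _ hy1) (Ideal.mul_mem_left _ _ hx1)
    have hp2 : p ∈ q₂ := by
      have : p = r * x - p * (y - 1) := by linear_combination e
      rw [this]
      exact sub_mem (Ideal.mul_mem_left _ _ hx2) (Ideal.mul_mem_left _ _ hy2)
    have ha : algebraMap R S a ∈ q₂ := by
      have := sub_mem hp2 ha2
      simpa using this
    have hp1 : p ∈ q₁ := by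
      have := add_mem ha1 ((hmem1 a).1 ((hmem2 a).2 ha))
      simpa using this
    obtain ⟨α, β, hαβ⟩ := Submodule.mem_span_pair.1 hn
    refine ⟨α • p + β • r, ?_, ?_⟩
    · change α • (p : FractionRing R) + β • (r : FractionRing R) = n * u
      rw [hp, hr, ← hαβ]
      simp only [Algebra.smul_def]
      ring
    · rw [Algebra.smul_def, Algebra.smul_def]
      exact add_mem (Ideal.mul_mem_left _ _ hp1) (Ideal.mul_mem_left _ _ hr1)
  have hall : ∀ t ∈ N * (N / N / N), ∃ w : S, (w : FractionRing R) = t ∧ w ∈ q₁ := by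
    intro t ht
    induction ht using Submodule.mul_induction_on' with
    | mem_mul_mem n hn u hu => exact key u hu n hn
    | add a _ b _ ha hb =>
      obtain ⟨v, hv, hv1⟩ := ha
      obtain ⟨w, hw, hw1⟩ := hb
      exact ⟨v + w, by rw [← hv, ← hw]; rfl, add_mem hv1 hw1⟩
  obtain ⟨w, hw, hw1⟩ := hall 1 hst
  have : w = 1 := Subtype.ext hw
  rw [this] at hw1
  exact hq₁.ne_top ((Ideal.eq_top_iff_one _).2 hw1)

lemma stable_of_quadratic (hQ : QuadraticClosureExtension R)
    (hP : PruferRing ↥(integralClosure R (FractionRing R)))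
    (h2 : ∀ m : Ideal R, m.IsMaximal →
          ∃ q₁ q₂ : Ideal ↥(integralClosure R (FractionRing R)),
            ∀ q : Ideal ↥(integralClosure R (FractionRing R)), q.IsMaximal →
              Ideal.comap (algebraMap R ↥(integralClosure R (FractionRing R))) q = m →
              q = q₁ ∨ q = q₂) : FinitelyStableRing R := by
  intro I hI hfg
  rw [stable_iff_stabSub I hI]
  let S := integralClosure R (FractionRing R)
  set N := IsLocalization.coeSubmodule (FractionRing R) I with hN
  by_contra hcon
  -- the ideal of elements of `R` in `N * (N / N / N)`
  let C : Ideal R := (N * (N / N / N)).comap (Algebra.linearMap R (FractionRing R))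
  have hC : C ≠ ⊤ := by
    intro ht
    apply hcon
    have : (1 : R) ∈ C := by rw [ht]; trivial
    change Algebra.linearMap R (FractionRing R) 1 ∈ N * (N / N / N) at this
    rw [Algebra.linearMap_apply, map_one] at this
    exact this
  obtain ⟨m, hm, hCm⟩ := Ideal.exists_le_maximal C hC
  obtain ⟨q₁, q₂, hq⟩ := h2 m hm
  let L : Ideal S := I.map (algebraMap R S)
  have hinj : Function.Injective (algebraMap R S) := FaithfulSMul.algebraMap_injective R S
  have hL : L ≠ ⊥ := by
    intro hb
    exact hI ((Ideal.map_eq_bot_iff_of_injective hinj).1 hb)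
  have hLinv := (invertible_iff (K := FractionRing R) L hL).1 (hP L hL (hfg.map _))
  set P := IsLocalization.coeSubmodule (FractionRing R) L with hPdef
  let M : Submodule S (FractionRing R) := 1 / P
  -- for a maximal ideal `q` the elements `a` with `a M ⊆ q`
  let B : Ideal S → AddSubgroup R := fun q =>
    { carrier := {a | ∀ t ∈ M, ∃ w ∈ q, (w : FractionRing R) = algebraMap R (FractionRing R) a * t}
      zero_mem' := fun t _ => ⟨0, q.zero_mem, by simp⟩
      add_mem' := by
        intro a b ha hb t ht
        obtain ⟨v, hv, hv'⟩ := ha t ht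
        obtain ⟨w, hw, hw'⟩ := hb t ht
        refine ⟨v + w, add_mem hv hw, ?_⟩
        rw [map_add, add_mul, ← hv', ← hw']
        rfl
      neg_mem' := by
        intro a ha t ht
        obtain ⟨v, hv, hv'⟩ := ha t ht
        refine ⟨-v, neg_mem hv, ?_⟩
        rw [map_neg, neg_mul, ← hv']
        rfl }
  have hB : ∀ q : Ideal S, q ≠ ⊤ → ¬ I.toAddSubgroup ≤ B q := by
    intro q hq hle
    have hLM : ∀ l ∈ P, ∀ t ∈ M, ∃ w ∈ q, (w : FractionRing R) = l * t := by
      rintro _ ⟨l, hl, rfl⟩ t ht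
      change l ∈ L at hl
      induction hl using Submodule.span_induction with
      | mem x hx =>
        obtain ⟨a, ha, rfl⟩ := hx
        exact hle ha t ht
      | zero => exact ⟨0, q.zero_mem, by simp⟩
      | add a b _ _ ha hb =>
        obtain ⟨v, hv, hv'⟩ := ha
        obtain ⟨w, hw, hw'⟩ := hb
        refine ⟨v + w, add_mem hv hw, ?_⟩
        rw [map_add, add_mul, ← hv', ← hw']
        rfl
      | smul r a _ ha =>
        obtain ⟨v, hv, hv'⟩ := ha
        refine ⟨r * v, q.mul_mem_left _ hv, ?_⟩
        rw [map_smul, smul_mul_assoc, ← hv']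
        rfl
    have hall : ∀ t ∈ P * M, ∃ w ∈ q, (w : FractionRing R) = t := by
      intro t ht
      induction ht using Submodule.mul_induction_on' with
      | mem_mul_mem n hn u hu => exact hLM n hn u hu
      | add a _ b _ ha hb =>
        obtain ⟨v, hv, hv'⟩ := ha
        obtain ⟨w, hw, hw'⟩ := hb
        exact ⟨v + w, add_mem hv hw, by rw [← hv', ← hw']; rfl⟩
    obtain ⟨w, hw, hw1⟩ := hall 1 hLinv
    have : w = 1 := Subtype.ext hw1
    rw [this] at hw
    exact hq ((Ideal.eq_top_iff_one _).2 hw)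
  obtain ⟨a, haI, ha⟩ : ∃ a ∈ I, ∀ q : Ideal S, q.IsMaximal →
      Ideal.comap (algebraMap R S) q = m → a ∉ B q := by
    by_contra! hno
    -- `q₁`, `q₂` may be improper or irrelevant; then replace them by the other one
    have hcov : ∃ p₁ p₂ : Ideal S, p₁ ≠ ⊤ ∧ p₂ ≠ ⊤ ∧ ∀ a ∈ I, a ∈ B p₁ ∨ a ∈ B p₂ := by
      obtain ⟨p, hp, hpm, -⟩ := hno 0 I.zero_mem
      by_cases t1 : q₁ = ⊤
      · by_cases t2 : q₂ = ⊤
        · rcases hq p hp hpm with rfl | rfl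
          · exact absurd t1 hp.ne_top
          · exact absurd t2 hp.ne_top
        · refine ⟨q₂, q₂, t2, t2, fun a ha => ?_⟩
          obtain ⟨p', hp', hpm', hap⟩ := hno a ha
          rcases hq p' hp' hpm' with rfl | rfl
          · exact absurd t1 hp'.ne_top
          · exact Or.inl hap
      · by_cases t2 : q₂ = ⊤
        · refine ⟨q₁, q₁, t1, t1, fun a ha => ?_⟩
          obtain ⟨p', hp', hpm', hap⟩ := hno a ha
          rcases hq p' hp' hpm' with rfl | rfl
          · exact Or.inl hap
          · exact absurd t2 hp'.ne_top
        · refine ⟨q₁, q₂, t1, t2, fun a ha => ?_⟩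
          obtain ⟨p', hp', hpm', hap⟩ := hno a ha
          rcases hq p' hp' hpm' with rfl | rfl
          · exact Or.inl hap
          · exact Or.inr hap
    obtain ⟨p₁, p₂, t1, t2, hcov⟩ := hcov
    have hsub : (I.toAddSubgroup : Set R) ⊆ (B p₁ : Set R) ∪ (B p₂ : Set R) :=
      fun a ha => hcov a ha
    rcases AddSubgroupClass.subset_union.1 hsub with h | h
    · exact hB p₁ t1 h
    · exact hB p₂ t2 h
  have haP : algebraMap R (FractionRing R) a ∈ P :=
    ⟨algebraMap R S a, Ideal.mem_map_of_mem _ haI, rfl⟩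
  -- the ideal `a M` of `S`
  let D : Ideal S :=
    (M.map (LinearMap.lsmul S (FractionRing R) (algebraMap R S a))).comap
      (Algebra.linearMap S (FractionRing R))
  have hD : ¬ D.comap (algebraMap R S) ≤ m := by
    intro hle
    obtain ⟨q, hDq, hqp, hqm⟩ := Ideal.exists_ideal_over_prime_of_isIntegral m D hle
    have hqmax : q.IsMaximal :=
      Ideal.isMaximal_of_isIntegral_of_isMaximal_comap (R := R) q (by rw [hqm]; exact hm)
    refine ha q hqmax hqm ?_
    intro t ht
    have h1 : t * algebraMap R (FractionRing R) a ∈ (1 : Submodule S (FractionRing R)) :=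
      Submodule.mem_div_iff_forall_mul_mem.1 ht _ haP
    obtain ⟨w, hw⟩ := Submodule.mem_one.1 h1
    rw [mul_comm] at hw
    exact ⟨w, hDq ⟨t, ht, hw.symm⟩, hw⟩
  obtain ⟨s, hsD, hsm⟩ := SetLike.not_le_iff_exists.1 hD
  obtain ⟨t, ht, hts⟩ := hsD
  have hts' : algebraMap R (FractionRing R) a * t = algebraMap R (FractionRing R) s := hts
  have hs0 : algebraMap R (FractionRing R) s ≠ 0 := by
    intro h0
    have : s = 0 := by simpa using h0
    exact hsm (this ▸ m.zero_mem)
  have ht0 : t ≠ 0 := by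
    rintro rfl
    exact hs0 (by rw [← hts', mul_zero])
  have ha0 : algebraMap R (FractionRing R) a ≠ 0 := by
    intro h0
    exact hs0 (by rw [← hts', h0, zero_mul])
  have htint : ∀ x ∈ N, x * t ∈ S := by
    rintro _ ⟨x, hx, rfl⟩
    have := Submodule.mem_div_iff_forall_mul_mem.1 ht (algebraMap R (FractionRing R) x)
      ⟨algebraMap R S x, Ideal.mem_map_of_mem _ hx, rfl⟩
    obtain ⟨w, hw⟩ := Submodule.mem_one.1 this
    rw [mul_comm] at hw
    change algebraMap R (FractionRing R) x * t ∈ S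
    rw [← hw]
    exact w.2
  have haN : algebraMap R (FractionRing R) a ∈ N := ⟨a, haI, rfl⟩
  -- `s * t` multiplies `N` into `E`
  have hst : algebraMap R (FractionRing R) s * t ∈ N / N / N := by
    rw [Submodule.mem_div_iff_forall_mul_mem]
    intro x hx
    rw [Submodule.mem_div_iff_forall_mul_mem]
    intro y hy
    obtain ⟨α, β, γ, hαβ⟩ := hQ _ _ (htint x hx) (htint y hy)
    have : algebraMap R (FractionRing R) s * t * x * y =
        (α * s) • x + (β * s) • y + γ • algebraMap R (FractionRing R) a := by
      simp only [Algebra.smul_def, map_mul]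
      rw [← hts']
      linear_combination (algebraMap R (FractionRing R) a) * hαβ
    rw [this]
    exact add_mem (add_mem (N.smul_mem _ hx) (N.smul_mem _ hy)) (N.smul_mem _ haN)
  have hsC : s * s ∈ C := by
    change Algebra.linearMap R (FractionRing R) (s * s) ∈ N * (N / N / N)
    have : Algebra.linearMap R (FractionRing R) (s * s) =
        algebraMap R (FractionRing R) a * (algebraMap R (FractionRing R) s * t) := by
      rw [Algebra.linearMap_apply, map_mul]
      nth_rewrite 1 [← hts']
      ring
    rw [this]
    exact Submodule.mul_mem_mul haN hst
  rcases hm.isPrime.mem_or_mem (hCm hsC) with h | h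
  · exact hsm h
  · exact hsm h

end Helpers

theorem finitely_stable_iff (R : Type*) [CommRing R] [IsDomain R] :
    FinitelyStableRing R ↔
      (QuadraticClosureExtension R ∧
        PruferRing ↥(integralClosure R (FractionRing R)) ∧
        ∀ m : Ideal R, m.IsMaximal →
          ∃ q₁ q₂ : Ideal ↥(integralClosure R (FractionRing R)),
            ∀ q : Ideal ↥(integralClosure R (FractionRing R)), q.IsMaximal →
              Ideal.comap (algebraMap R ↥(integralClosure R (FractionRing R))) q = m →
              q = q₁ ∨ q = q₂) := by
  exact ⟨fun h => ⟨quadratic_of_stable h, prufer_of_stable h, two_of_stable h⟩,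
    fun ⟨hQ, hP, h2⟩ => stable_of_quadratic hQ hP h2⟩
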